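/- The twisted forms of K₃ × K₃ over F are, up to isomorphism, exactly the superalgebras K₃ ⊗_F K where K is a quadratic étale F-algebra (with even part Fa ⊗ K and odd part W ⊗ K), and two such forms K₃ ⊗_F K and K₃ ⊗_F K' are isomorphic as F-superalgebras if and only if K and K' are isomorphic as F-algebras. -/

import Mathlib

open scoped TensorProduct
noncomputable section
namespace Kac

/-! ### Superalgebra isomorphisms and automorphisms -/

@[ext]
structure SuperIso (S A B : Type) [CommRing S]
    [AddCommGroup A] [Module S A] [Mul A]
    [AddCommGroup B] [Module S B] [Mul B]
    (evA odA : Submodule S A) (evB odB : Submodule S B) : Type where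
  e : A ≃ₗ[S] B
  map_mul' : ∀ x y : A, e (x * y) = e x * e y
  map_even : evA.map e.toLinearMap = evB
  map_odd : odA.map e.toLinearMap = odB

abbrev SuperAut (S A : Type) [CommRing S] [AddCommGroup A] [Module S A] [Mul A]
    (ev od : Submodule S A) := SuperIso S A A ev od ev od

namespace SuperAut

variable {S A : Type} [CommRing S] [AddCommGroup A] [Module S A] [Mul A]
variable {ev od : Submodule S A}

private lemma map_symm {f : A ≃ₗ[S] A} {p : Submodule S A}
    (h : p.map f.toLinearMap = p) : p.map f.symm.toLinearMap = p := by
  have h2 : f.symm.toLinearMap.comp f.toLinearMap = LinearMap.id := by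
    ext x; simp
  calc p.map f.symm.toLinearMap
      = (p.map f.toLinearMap).map f.symm.toLinearMap := by rw [h]
    _ = p.map (f.symm.toLinearMap.comp f.toLinearMap) := by
        rw [Submodule.map_comp]
    _ = p := by rw [h2, Submodule.map_id]

instance : Group (SuperAut S A ev od) where
  one := ⟨LinearEquiv.refl S A, fun _ _ => rfl, Submodule.map_id _, Submodule.map_id _⟩
  mul f g := ⟨g.e.trans f.e,
    fun x y => by simp [LinearEquiv.trans_apply, g.map_mul', f.map_mul'],
    by rw [LinearEquiv.coe_trans, Submodule.map_comp, g.map_even, f.map_even],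
    by rw [LinearEquiv.coe_trans, Submodule.map_comp, g.map_odd, f.map_odd]⟩
  inv f := ⟨f.e.symm,
    fun x y => f.e.injective <| by simp [f.map_mul'],
    map_symm f.map_even, map_symm f.map_odd⟩
  mul_assoc f g h := by apply SuperIso.ext; apply LinearEquiv.ext; intro x; rfl
  one_mul f := by apply SuperIso.ext; apply LinearEquiv.ext; intro x; rfl
  mul_one f := by apply SuperIso.ext; apply LinearEquiv.ext; intro x; rfl
  inv_mul_cancel f := by
    apply SuperIso.ext; apply LinearEquiv.ext; intro x
    exact f.e.symm_apply_apply x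

end SuperAut

/-- The predicate that a pair of submodules `ev`, `od` makes a non-unital
(possibly non-associative) algebra `B` into a superalgebra. -/
def IsSuperalgebra (S B : Type) [CommRing S] [NonUnitalNonAssocRing B] [Module S B]
    (ev od : Submodule S B) : Prop :=
  ev ⊔ od = ⊤ ∧ ev ⊓ od = ⊥ ∧
  (∀ x ∈ ev, ∀ y ∈ ev, x * y ∈ ev) ∧ (∀ x ∈ ev, ∀ y ∈ od, x * y ∈ od) ∧
  (∀ x ∈ od, ∀ y ∈ ev, x * y ∈ od) ∧ (∀ x ∈ od, ∀ y ∈ od, x * y ∈ ev)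

/-! ### Submodules given by vanishing of coordinates -/

def stdSub (S R : Type) [Semiring S] [AddCommGroup R] [Module S R] (n : ℕ)
    (s : Set (Fin n)) : Submodule S (Fin n → R) where
  carrier := {x | ∀ i, i ∉ s → x i = 0}
  add_mem' := fun {a b} ha hb i hi => by
    simp [Pi.add_apply, ha i hi, hb i hi]
  zero_mem' := fun i _ => rfl
  smul_mem' := fun c x hx i hi => by
    simp [Pi.smul_apply, hx i hi]

/-! ### Gradings by abelian groups -/

section Gradings

variable {G H S A : Type} [CommGroup G] [CommGroup H] [CommRing S]
  [AddCommGroup A] [Module S A] [Mul A]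

/-- `comp` is a `G`-grading of the superalgebra `(A, ev, od)`. -/
def IsSuperGrading (ev od : Submodule S A) (comp : G → Submodule S A) : Prop :=
  (letI := Classical.decEq G; DirectSum.IsInternal comp) ∧
  (∀ (g h : G) (x y : A), x ∈ comp g → y ∈ comp h → x * y ∈ comp (g * h)) ∧
  (∀ g, comp g = (comp g ⊓ ev) ⊔ (comp g ⊓ od))

/-- The grading with homogeneous elements `w i` of degrees `d i`. -/
def gradingOf (S : Type) {A G : Type} [CommRing S] [AddCommGroup A] [Module S A]
    [CommGroup G] {n : ℕ} (w : Fin n → A) (d : Fin n → G) : G → Submodule S A :=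
  fun g => Submodule.span S (w '' {i | d i = g})

/-- Isomorphism of two `G`-gradings on a superalgebra. -/
def GradIso (ev od : Submodule S A) (comp comp' : G → Submodule S A) : Prop :=
  ∃ φ : SuperAut S A ev od, ∀ g, (comp g).map φ.e.toLinearMap = comp' g

/-- `Δ` refines `Γ`. -/
def Refines (Δ : H → Submodule S A) (Γ : G → Submodule S A) : Prop :=
  ∀ h, Δ h ≠ ⊥ → ∃ g, Δ h ≤ Γ g

/-- Equivalence of a `G`-grading and an `H`-grading on a superalgebra. -/
def GradEquiv (ev od : Submodule S A) (Γ : G → Submodule S A)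
    (Δ : H → Submodule S A) : Prop :=
  ∃ φ : SuperAut S A ev od, ∃ α : {g : G // Γ g ≠ ⊥} → {h : H // Δ h ≠ ⊥},
    Function.Bijective α ∧
    ∀ g : {g : G // Γ g ≠ ⊥}, (Γ g.1).map φ.e.toLinearMap = Δ (α g).1

/-- A grading is fine if any grading refining it has the same nonzero
homogeneous components. -/
def IsFine (ev od : Submodule S A) (Γ : G → Submodule S A) : Prop :=
  ∀ (H : Type) (_ : CommGroup H) (Δ : H → Submodule S A),
    IsSuperGrading ev od Δ → Refines Δ Γ →
      {p : Submodule S A | p ≠ ⊥ ∧ ∃ h, Δ h = p} =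
      {p : Submodule S A | p ≠ ⊥ ∧ ∃ g, Γ g = p}

end Gradings

/-! ### SL₂ and the semidirect product with C₂ -/

abbrev SL2 (R : Type) [CommRing R] := Matrix.SpecialLinearGroup (Fin 2) R

def swapAut (M : Type) [Monoid M] : MulAut (M × M) := MulEquiv.prodComm

lemma swapAut_sq (M : Type) [Monoid M] : swapAut M * swapAut M = 1 :=
  MulEquiv.ext fun _ => rfl

/-- The action of `C₂ = Multiplicative (ZMod 2)` on `M × M` by swapping the factors. -/
def swapHom (M : Type) [Group M] : Multiplicative (ZMod 2) →* MulAut (M × M) :=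
  MonoidHom.mk' (fun c => if c.toAdd = 0 then 1 else swapAut M) (by
    intro a b
    have key : ∀ c : Multiplicative (ZMod 2),
        c = Multiplicative.ofAdd 0 ∨ c = Multiplicative.ofAdd 1 := by decide
    rcases key a with rfl | rfl <;> rcases key b with rfl | rfl <;>
      simp [← ofAdd_add, swapAut_sq] <;> exact fun h => absurd (by decide) h)

end Kac
/-! ### The (base-changed) Kaplansky superalgebra `K₃ ⊗ R` -/

namespace Kac

section Algebras

variable (F : Type) [Field F] (R : Type) [CommRing R] [Algebra F R]

/-- Coordinates: `0 ↦ a`, `1 ↦ u`, `2 ↦ v`. -/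
def K3A (F : Type) [Field F] (R : Type) [CommRing R] [Algebra F R] : Type := Fin 3 → R

instance : AddCommGroup (K3A F R) := Pi.addCommGroup
instance (S : Type) [Semiring S] [Module S R] : Module S (K3A F R) := Pi.module _ _ _

namespace K3A
variable {F R}

def mulFun (x y : K3A F R) : K3A F R := fun i =>
  match i with
  | ⟨0, _⟩ => x 0 * y 0 + (x 1 * y 2 - x 2 * y 1)
  | ⟨1, _⟩ => algebraMap F R 2⁻¹ * (x 0 * y 1 + y 0 * x 1)
  | ⟨2, _⟩ => algebraMap F R 2⁻¹ * (x 0 * y 2 + y 0 * x 2)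

instance : Mul (K3A F R) := ⟨mulFun⟩

lemma mul_def (x y : K3A F R) : x * y = mulFun x y := rfl

@[simp] lemma add_apply (x y : K3A F R) (i : Fin 3) : (x + y) i = x i + y i := rfl
@[simp] lemma sub_apply (x y : K3A F R) (i : Fin 3) : (x - y) i = x i - y i := rfl
@[simp] lemma neg_apply (x : K3A F R) (i : Fin 3) : (-x) i = -(x i) := rfl
@[simp] lemma zero_apply (i : Fin 3) : (0 : K3A F R) i = 0 := rfl
@[simp] lemma smul_apply (S : Type) [Semiring S] [Module S R] (c : S) (x : K3A F R) (i : Fin 3) :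
    (c • x) i = c • (x i) := rfl

variable (F R)

/-- The even part `R·a`. -/
def even (S : Type) [Semiring S] [Module S R] : Submodule S (K3A F R) := stdSub S R 3 {0}
/-- The odd part `W ⊗ R`. -/
def odd (S : Type) [Semiring S] [Module S R] : Submodule S (K3A F R) := stdSub S R 3 {1, 2}

/-- The element `a`. -/
def aE : K3A F R := ![1, 0, 0]
/-- The element of `W ⊗ R` with coordinates `w` in the symplectic basis `{u, v}`. -/
def wE (w : Fin 2 → R) : K3A F R := ![0, w 0, w 1]

end K3A

/-- `J(W) ⊗ R`; coordinates: `0 ↦ 1`, `1 ↦ u`, `2 ↦ v`. -/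
def JW1A (R : Type) [CommRing R] : Type := Fin 3 → R

instance : AddCommGroup (JW1A R) := Pi.addCommGroup
instance (S : Type) [Semiring S] [Module S R] : Module S (JW1A R) := Pi.module _ _ _

namespace JW1A
variable {R}

def mulFun (x y : JW1A R) : JW1A R := fun i =>
  match i with
  | ⟨0, _⟩ => x 0 * y 0 + (x 1 * y 2 - x 2 * y 1)
  | ⟨1, _⟩ => x 0 * y 1 + y 0 * x 1
  | ⟨2, _⟩ => x 0 * y 2 + y 0 * x 2

instance : Mul (JW1A R) := ⟨mulFun⟩

lemma mul_def (x y : JW1A R) : x * y = mulFun x y := rfl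

@[simp] lemma add_apply (x y : JW1A R) (i : Fin 3) : (x + y) i = x i + y i := rfl
@[simp] lemma sub_apply (x y : JW1A R) (i : Fin 3) : (x - y) i = x i - y i := rfl
@[simp] lemma neg_apply (x : JW1A R) (i : Fin 3) : (-x) i = -(x i) := rfl
@[simp] lemma zero_apply (i : Fin 3) : (0 : JW1A R) i = 0 := rfl
@[simp] lemma smul_apply (S : Type) [Semiring S] [Module S R] (c : S) (x : JW1A R) (i : Fin 3) :
    (c • x) i = c • (x i) := rfl

variable (R)

def even (S : Type) [Semiring S] [Module S R] : Submodule S (JW1A R) := stdSub S R 3 {0}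
def odd (S : Type) [Semiring S] [Module S R] : Submodule S (JW1A R) := stdSub S R 3 {1, 2}

def oneE : JW1A R := ![1, 0, 0]
def wE (w : Fin 2 → R) : JW1A R := ![0, w 0, w 1]

end JW1A

/-- `(K₃ × K₃) ⊗ R`; coordinates `0,1,2` for the first copy (`a,u,v`),
`3,4,5` for the second copy. -/
def K33A (F : Type) [Field F] (R : Type) [CommRing R] [Algebra F R] : Type := Fin 6 → R

instance : AddCommGroup (K33A F R) := Pi.addCommGroup
instance (S : Type) [Semiring S] [Module S R] : Module S (K33A F R) := Pi.module _ _ _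

namespace K33A
variable {F R}

def mulFun (x y : K33A F R) : K33A F R := fun i =>
  match i with
  | ⟨0, _⟩ => x 0 * y 0 + (x 1 * y 2 - x 2 * y 1)
  | ⟨1, _⟩ => algebraMap F R 2⁻¹ * (x 0 * y 1 + y 0 * x 1)
  | ⟨2, _⟩ => algebraMap F R 2⁻¹ * (x 0 * y 2 + y 0 * x 2)
  | ⟨3, _⟩ => x 3 * y 3 + (x 4 * y 5 - x 5 * y 4)
  | ⟨4, _⟩ => algebraMap F R 2⁻¹ * (x 3 * y 4 + y 3 * x 4)
  | ⟨5, _⟩ => algebraMap F R 2⁻¹ * (x 3 * y 5 + y 3 * x 5)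

instance : Mul (K33A F R) := ⟨mulFun⟩

lemma mul_def (x y : K33A F R) : x * y = mulFun x y := rfl

@[simp] lemma add_apply (x y : K33A F R) (i : Fin 6) : (x + y) i = x i + y i := rfl
@[simp] lemma sub_apply (x y : K33A F R) (i : Fin 6) : (x - y) i = x i - y i := rfl
@[simp] lemma neg_apply (x : K33A F R) (i : Fin 6) : (-x) i = -(x i) := rfl
@[simp] lemma zero_apply (i : Fin 6) : (0 : K33A F R) i = 0 := rfl
@[simp] lemma smul_apply (S : Type) [Semiring S] [Module S R] (c : S) (x : K33A F R) (i : Fin 6) :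
    (c • x) i = c • (x i) := rfl

variable (F R)

def even (S : Type) [Semiring S] [Module S R] : Submodule S (K33A F R) := stdSub S R 6 {0, 3}
def odd (S : Type) [Semiring S] [Module S R] : Submodule S (K33A F R) := stdSub S R 6 {1, 2, 4, 5}

/-- The element `(a, 0)`. -/
def aLeft : K33A F R := ![1, 0, 0, 0, 0, 0]
/-- The element `(0, a)`. -/
def aRight : K33A F R := ![0, 0, 0, 1, 0, 0]
/-- The element `(v, w)` of the odd part, `v, w ∈ W ⊗ R`. -/
def oddE (w w' : Fin 2 → R) : K33A F R := ![0, w 0, w 1, 0, w' 0, w' 1]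
/-- The exchange automorphism `(x, y) ↦ (y, x)`. -/
def swapFun (x : K33A F R) : K33A F R := fun i =>
  match i with
  | ⟨0, _⟩ => x 3
  | ⟨1, _⟩ => x 4
  | ⟨2, _⟩ => x 5
  | ⟨3, _⟩ => x 0
  | ⟨4, _⟩ => x 1
  | ⟨5, _⟩ => x 2

end K33A

/-- `(J(W) × J(W)) ⊗ R`. -/
def JW2A (R : Type) [CommRing R] : Type := Fin 6 → R

instance : AddCommGroup (JW2A R) := Pi.addCommGroup
instance (S : Type) [Semiring S] [Module S R] : Module S (JW2A R) := Pi.module _ _ _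

namespace JW2A
variable {R}

def mulFun (x y : JW2A R) : JW2A R := fun i =>
  match i with
  | ⟨0, _⟩ => x 0 * y 0 + (x 1 * y 2 - x 2 * y 1)
  | ⟨1, _⟩ => x 0 * y 1 + y 0 * x 1
  | ⟨2, _⟩ => x 0 * y 2 + y 0 * x 2
  | ⟨3, _⟩ => x 3 * y 3 + (x 4 * y 5 - x 5 * y 4)
  | ⟨4, _⟩ => x 3 * y 4 + y 3 * x 4
  | ⟨5, _⟩ => x 3 * y 5 + y 3 * x 5

instance : Mul (JW2A R) := ⟨mulFun⟩

lemma mul_def (x y : JW2A R) : x * y = mulFun x y := rfl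

@[simp] lemma add_apply (x y : JW2A R) (i : Fin 6) : (x + y) i = x i + y i := rfl
@[simp] lemma sub_apply (x y : JW2A R) (i : Fin 6) : (x - y) i = x i - y i := rfl
@[simp] lemma neg_apply (x : JW2A R) (i : Fin 6) : (-x) i = -(x i) := rfl
@[simp] lemma zero_apply (i : Fin 6) : (0 : JW2A R) i = 0 := rfl
@[simp] lemma smul_apply (S : Type) [Semiring S] [Module S R] (c : S) (x : JW2A R) (i : Fin 6) :
    (c • x) i = c • (x i) := rfl

variable (R)

def even (S : Type) [Semiring S] [Module S R] : Submodule S (JW2A R) := stdSub S R 6 {0, 3}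
def odd (S : Type) [Semiring S] [Module S R] : Submodule S (JW2A R) := stdSub S R 6 {1, 2, 4, 5}

/-- The element `(1, 0)`. -/
def oneLeft : JW2A R := ![1, 0, 0, 0, 0, 0]
/-- The element `(0, 1)`. -/
def oneRight : JW2A R := ![0, 0, 0, 1, 0, 0]
def oddE (w w' : Fin 2 → R) : JW2A R := ![0, w 0, w 1, 0, w' 0, w' 1]
def swapFun (x : JW2A R) : JW2A R := fun i =>
  match i with
  | ⟨0, _⟩ => x 3
  | ⟨1, _⟩ => x 4
  | ⟨2, _⟩ => x 5
  | ⟨3, _⟩ => x 0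
  | ⟨4, _⟩ => x 1
  | ⟨5, _⟩ => x 2

end JW2A

/-- Kac's superalgebra `K₁₀ ⊗ R`.  CoordinatesL `0 ↦ 1`, `1 ↦ a⊗a`,
`2 ↦ u⊗u`, `3 ↦ u⊗v`, `4 ↦ v⊗u`, `5 ↦ v⊗v`, `6 ↦ u⊗a`, `7 ↦ v⊗a`,
`8 ↦ a⊗u`, `9 ↦ a⊗v`. -/
def K10A (F : Type) [Field F] (R : Type) [CommRing R] [Algebra F R] : Type := Fin 10 → R

instance : AddCommGroup (K10A F R) := Pi.addCommGroup
instance (S : Type) [Semiring S] [Module S R] : Module S (K10A F R) := Pi.module _ _ _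

namespace K10A
variable {F R}

def mulFun (x y : K10A F R) : K10A F R := fun i =>
  match i with
  | ⟨0, _⟩ => x 0 * y 0 - algebraMap F R (3/16) * (x 1 * y 1)
      + algebraMap F R (3/4) * (x 2 * y 5 + x 5 * y 2 - x 3 * y 4 - x 4 * y 3)
      - algebraMap F R (3/8) * (x 6 * y 7 - x 7 * y 6 + x 8 * y 9 - x 9 * y 8)
  | ⟨1, _⟩ => x 0 * y 1 + x 1 * y 0 + x 1 * y 1
      - (x 2 * y 5 + x 5 * y 2 - x 3 * y 4 - x 4 * y 3)
      + (x 6 * y 7 - x 7 * y 6) + (x 8 * y 9 - x 9 * y 8)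
  | ⟨2, _⟩ => x 0 * y 2 + x 2 * y 0 + algebraMap F R 4⁻¹ * (x 1 * y 2 + x 2 * y 1)
      + algebraMap F R 4⁻¹ * (x 6 * y 8 - x 8 * y 6)
  | ⟨3, _⟩ => x 0 * y 3 + x 3 * y 0 + algebraMap F R 4⁻¹ * (x 1 * y 3 + x 3 * y 1)
      + algebraMap F R 4⁻¹ * (x 6 * y 9 - x 9 * y 6)
  | ⟨4, _⟩ => x 0 * y 4 + x 4 * y 0 + algebraMap F R 4⁻¹ * (x 1 * y 4 + x 4 * y 1)
      + algebraMap F R 4⁻¹ * (x 7 * y 8 - x 8 * y 7)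
  | ⟨5, _⟩ => x 0 * y 5 + x 5 * y 0 + algebraMap F R 4⁻¹ * (x 1 * y 5 + x 5 * y 1)
      + algebraMap F R 4⁻¹ * (x 7 * y 9 - x 9 * y 7)
  | ⟨6, _⟩ => x 0 * y 6 + x 6 * y 0 + algebraMap F R 2⁻¹ * (x 1 * y 6 + x 6 * y 1)
      + algebraMap F R 2⁻¹ * (x 2 * y 9 + x 9 * y 2) - algebraMap F R 2⁻¹ * (x 3 * y 8 + x 8 * y 3)
  | ⟨7, _⟩ => x 0 * y 7 + x 7 * y 0 + algebraMap F R 2⁻¹ * (x 1 * y 7 + x 7 * y 1)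
      + algebraMap F R 2⁻¹ * (x 4 * y 9 + x 9 * y 4) - algebraMap F R 2⁻¹ * (x 5 * y 8 + x 8 * y 5)
  | ⟨8, _⟩ => x 0 * y 8 + x 8 * y 0 + algebraMap F R 2⁻¹ * (x 1 * y 8 + x 8 * y 1)
      - algebraMap F R 2⁻¹ * (x 2 * y 7 + x 7 * y 2) + algebraMap F R 2⁻¹ * (x 4 * y 6 + x 6 * y 4)
  | ⟨9, _⟩ => x 0 * y 9 + x 9 * y 0 + algebraMap F R 2⁻¹ * (x 1 * y 9 + x 9 * y 1)
      - algebraMap F R 2⁻¹ * (x 3 * y 7 + x 7 * y 3) + algebraMap F R 2⁻¹ * (x 5 * y 6 + x 6 * y 5)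

instance : Mul (K10A F R) := ⟨mulFun⟩

lemma mul_def (x y : K10A F R) : x * y = mulFun x y := rfl

@[simp] lemma add_apply (x y : K10A F R) (i : Fin 10) : (x + y) i = x i + y i := rfl
@[simp] lemma sub_apply (x y : K10A F R) (i : Fin 10) : (x - y) i = x i - y i := rfl
@[simp] lemma neg_apply (x : K10A F R) (i : Fin 10) : (-x) i = -(x i) := rfl
@[simp] lemma zero_apply (i : Fin 10) : (0 : K10A F R) i = 0 := rfl
@[simp] lemma smul_apply (S : Type) [Semiring S] [Module S R] (c : S) (x : K10A F R) (i : Fin 10) :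
    (c • x) i = c • (x i) := rfl

variable (F R)

def even (S : Type) [Semiring S] [Module S R] : Submodule S (K10A F R) :=
  stdSub S R 10 {0, 1, 2, 3, 4, 5}
def odd (S : Type) [Semiring S] [Module S R] : Submodule S (K10A F R) :=
  stdSub S R 10 {6, 7, 8, 9}

/-- The unity `1`. -/
def oneE : K10A F R := ![1, 0, 0, 0, 0, 0, 0, 0, 0, 0]
/-- The element `a ⊗ a`. -/
def aaE : K10A F R := ![0, 1, 0, 0, 0, 0, 0, 0, 0, 0]
/-- The element `v ⊗ w ∈ W ⊗ W`. -/
def wwE (w w' : Fin 2 → R) : K10A F R :=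
  ![0, 0, w 0 * w' 0, w 0 * w' 1, w 1 * w' 0, w 1 * w' 1, 0, 0, 0, 0]
/-- The element `w ⊗ a`, `w ∈ W ⊗ R`. -/
def waE (w : Fin 2 → R) : K10A F R := ![0, 0, 0, 0, 0, 0, w 0, w 1, 0, 0]
/-- The element `a ⊗ w`, `w ∈ W ⊗ R`. -/
def awE (w : Fin 2 → R) : K10A F R := ![0, 0, 0, 0, 0, 0, 0, 0, w 0, w 1]
/-- The exchange automorphism `τ`, `τ(x ⊗ y) = (-1)^{|x||y|} y ⊗ x`. -/
def tauFun (x : K10A F R) : K10A F R := fun i =>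
  match i with
  | ⟨0, _⟩ => x 0
  | ⟨1, _⟩ => x 1
  | ⟨2, _⟩ => -x 2
  | ⟨3, _⟩ => -x 4
  | ⟨4, _⟩ => -x 3
  | ⟨5, _⟩ => -x 5
  | ⟨6, _⟩ => x 8
  | ⟨7, _⟩ => x 9
  | ⟨8, _⟩ => x 6
  | ⟨9, _⟩ => x 7

end K10A

end Algebras

end Kac

namespace Kac

/-- `p` (a submodule of `B`, e.g. the even part) is isomorphic, as an
`F`-algebra, to `C`: there is an `F`-linear bijection preserving products. -/
def SubAlgIso (F B C : Type) [Field F] [NonUnitalNonAssocRing B] [Module F B]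
    [Ring C] [Algebra F C] (p : Submodule F B) : Prop :=
  ∃ e : p ≃ₗ[F] C, ∀ (x y : p) (h : (x : B) * (y : B) ∈ p),
    e ⟨(x : B) * (y : B), h⟩ = e x * e y

/-- A quadratic étale `F`-algebra: two-dimensional, and either isomorphic to
`F × F` or a (quadratic) separable field extension of `F`. -/
def IsQuadraticEtale (F K : Type) [Field F] [CommRing K] [Algebra F K] : Prop :=
  Module.finrank F K = 2 ∧
    (Nonempty (K ≃ₐ[F] (F × F)) ∨ (IsField K ∧ Algebra.IsSeparable F K))

end Kac

/-! ### STATEMENT 11 -/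

namespace Kac

/-- A witness that the superalgebra `B` is isomorphic to `K₃ ⊗_F K`
(realized as `K3A F K`) for some quadratic étale `F`-algebra `K`. -/
structure QuadEtaleWitness (F : Type) [Field F] (B : Type) [NonUnitalNonAssocRing B]
    [Module F B] (evB odB : Submodule F B) : Type 1 where
  K : Type
  [commRing : CommRing K]
  [alg : Algebra F K]
  etale : IsQuadraticEtale F K
  iso : SuperIso F B (K3A F K) evB odB (K3A.even F K F) (K3A.odd F K F)

end Kac

namespace Kac

/-- A linear equivalence that carries two spanning submodules into two disjoint submodules carries
them onto those submodules. -/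
lemma map_eq_of_le_of_disjoint {S A B : Type} [CommRing S] [AddCommGroup A] [Module S A]
    [AddCommGroup B] [Module S B] (e : A ≃ₗ[S] B) {p q : Submodule S A} {p' q' : Submodule S B}
    (hpq : p ⊔ q = ⊤) (hpq' : p' ⊓ q' = ⊥) (hp : ∀ x ∈ p, e x ∈ p') (hq : ∀ x ∈ q, e x ∈ q') :
    p.map e.toLinearMap = p' ∧ q.map e.toLinearMap = q' := by
  have key : ∀ y, ∃ a ∈ p, ∃ b ∈ q, e a + e b = y := fun y => by
    obtain ⟨a, ha, b, hb, hab⟩ := Submodule.mem_sup.1 (hpq ▸ Submodule.mem_top : e.symm y ∈ p ⊔ q)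
    exact ⟨a, ha, b, hb, by rw [← map_add, hab, e.apply_symm_apply]⟩
  have zero_of_mem : ∀ y ∈ p', y ∈ q' → y = 0 := fun y h h' =>
    (Submodule.mem_bot S).1 (hpq' ▸ ⟨h, h'⟩)
  constructor
  · refine le_antisymm (Submodule.map_le_iff_le_comap.2 hp) fun y hy => ?_
    obtain ⟨a, ha, b, hb, rfl⟩ := key y
    have hb0 : e b = 0 := zero_of_mem _ (by simpa using p'.sub_mem hy (hp a ha)) (hq b hb)
    exact ⟨a, ha, by simp [hb0]⟩
  · refine le_antisymm (Submodule.map_le_iff_le_comap.2 hq) fun y hy => ?_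
    obtain ⟨a, ha, b, hb, rfl⟩ := key y
    have ha0 : e a = 0 := zero_of_mem _ (hp a ha) (by simpa using q'.sub_mem hy (hq b hb))
    exact ⟨b, hb, by simp [ha0]⟩

section

variable {S A B : Type} [CommRing S] [AddCommGroup A] [Module S A] [Mul A]
  [AddCommGroup B] [Module S B] [Mul B] {evA odA : Submodule S A} {evB odB : Submodule S B}

/-- The inverse of an isomorphism of superalgebras. -/
def SuperIso.symm (f : SuperIso S A B evA odA evB odB) : SuperIso S B A evB odB evA odA where
  e := f.e.symm
  map_mul' x y := f.e.injective <| by simp [f.map_mul']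
  map_even := (Submodule.map_symm_eq_iff f.e).2 f.map_even
  map_odd := (Submodule.map_symm_eq_iff f.e).2 f.map_odd

lemma SuperIso.apply_mem_even (f : SuperIso S A B evA odA evB odB) {x : A} (hx : x ∈ evA) :
    f.e x ∈ evB :=
  f.map_even.le (Submodule.mem_map_of_mem hx)

lemma SuperIso.apply_mem_odd (f : SuperIso S A B evA odA evB odB) {x : A} (hx : x ∈ odA) :
    f.e x ∈ odB :=
  f.map_odd.le (Submodule.mem_map_of_mem hx)

end

/-- Two nonzero linear maps are simultaneously nonzero at some vector. -/
lemma exists_apply_ne_zero_and {F V M N : Type*} [Field F] [AddCommGroup V] [Module F V]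
    [AddCommGroup M] [Module F M] [AddCommGroup N] [Module F N] {f : V →ₗ[F] M} {g : V →ₗ[F] N}
    (hf : f ≠ 0) (hg : g ≠ 0) : ∃ x, f x ≠ 0 ∧ g x ≠ 0 := by
  obtain ⟨x, hx⟩ := DFunLike.ne_iff.1 hf
  obtain ⟨y, hy⟩ := DFunLike.ne_iff.1 hg
  simp only [LinearMap.zero_apply] at hx hy
  by_cases hgx : g x = 0
  · by_cases hfy : f y = 0
    · exact ⟨x + y, by simpa [hfy] using hx, by simpa [hgx] using hy⟩
    · exact ⟨y, hfy, hy⟩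
  · exact ⟨x, hx, hgx⟩

/-- A two-dimensional commutative algebra with an idempotent other than `0` and `1` is split. -/
lemma nonempty_algEquiv_prod_of_isIdempotentElem {F K : Type} [Field F] [CommRing K] [Algebra F K]
    (hK : Module.finrank F K = 2) {e : K} (he : e * e = e) (h0 : e ≠ 0) (h1 : e ≠ 1) :
    Nonempty (K ≃ₐ[F] (F × F)) := by
  have : FiniteDimensional F K := .of_finrank_pos (by omega)
  let f : (F × F) →ₗ[F] K :=
    (LinearMap.toSpanSingleton F K e).coprod (LinearMap.toSpanSingleton F K (1 - e))
  have hf : ∀ x, f x = x.1 • e + x.2 • (1 - e) := fun x => by simp [f]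
  have hinj : Function.Injective f := by
    refine (injective_iff_map_eq_zero f).2 fun x hx => ?_
    rw [hf] at hx
    have hx1 : x.1 • e = 0 := by
      have := congrArg (· * e) hx
      simpa [add_mul, sub_mul, he] using this
    have hx2 : x.2 • (1 - e) = 0 := by simpa [hx1] using hx
    exact Prod.ext ((smul_eq_zero.1 hx1).resolve_right h0)
      ((smul_eq_zero.1 hx2).resolve_right (sub_ne_zero.2 h1.symm))
  let g := LinearEquiv.ofInjectiveOfFinrankEq f hinj (by simp [hK])
  have hg : ∀ x, g x = x.1 • e + x.2 • (1 - e) := hf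
  refine ⟨(AlgEquiv.ofLinearEquiv g (by simp [hg]) fun x y => ?_).symm⟩
  simp only [hg, Prod.fst_mul, Prod.snd_mul, Algebra.smul_def, map_mul]
  linear_combination (algebraMap F K x.1 - algebraMap F K x.2) *
    (algebraMap F K y.2 - algebraMap F K y.1) * he

/-- In characteristic not two, a field extension of degree two is separable. -/
lemma isSeparable_of_finrank_eq_two {F K : Type*} [Field F] [Field K] [Algebra F K]
    (hchar : (2 : F) ≠ 0) (hK : Module.finrank F K = 2) : Algebra.IsSeparable F K := by
  have : FiniteDimensional F K := .of_finrank_pos (by omega)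
  refine ⟨fun x => ?_⟩
  have hx := Algebra.IsIntegral.isIntegral (R := F) x
  refine (Polynomial.separable_iff_derivative_ne_zero (minpoly.irreducible hx)).2 fun h => ?_
  have hle : (minpoly F x).natDegree ≤ 2 := hK ▸ minpoly.natDegree_le x
  have hpos := minpoly.natDegree_pos hx
  have hc := congrArg (Polynomial.coeff · ((minpoly F x).natDegree - 1)) h
  simp only [Polynomial.coeff_derivative, Polynomial.coeff_zero, Nat.sub_add_cancel hpos,
    (minpoly.monic hx).coeff_natDegree] at hc
  interval_cases (minpoly F x).natDegree
  · norm_num at hc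
  · norm_num [hchar] at hc

/-- In characteristic not two, a reduced two-dimensional commutative algebra is étale. -/
lemma isQuadraticEtale_of_isReduced {F K : Type} [Field F] [CommRing K] [Algebra F K]
    [IsReduced K] (hchar : (2 : F) ≠ 0) (hK : Module.finrank F K = 2) :
    IsQuadraticEtale F K := by
  have : FiniteDimensional F K := .of_finrank_pos (by omega)
  have : Nontrivial K := Module.nontrivial_of_finrank_pos (R := F) (by omega)
  refine ⟨hK, ?_⟩
  by_cases hfield : IsField K
  · let := hfield.toField
    exact .inr ⟨hfield, isSeparable_of_finrank_eq_two hchar hK⟩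
  obtain ⟨x, hx0, hxu⟩ := Ring.exists_not_isUnit_of_not_isField hfield
  have hli : LinearIndependent F ![1, x] := by
    refine LinearIndependent.pair_symm_iff.1 <| (LinearIndependent.pair_iff' hx0).2 fun a ha => hxu ?_
    exact IsUnit.of_mul_eq_one (algebraMap F K a) (by rw [mul_comm, ← Algebra.smul_def, ha])
  have hspan := hli.span_eq_top_of_card_eq_finrank (by simp [hK])
  obtain ⟨a, b, hab⟩ : ∃ a b : F, a • x + b • (1 : K) = x * x := by
    have : x * x ∈ Submodule.span F (Set.range ![1, x]) := hspan ▸ Submodule.mem_top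
    simpa [Matrix.range_cons, Matrix.range_empty, Submodule.mem_span_pair] using this
  rw [Algebra.smul_def, Algebra.smul_def] at hab
  have hb : b = 0 := by
    by_contra hb
    refine hxu (IsUnit.of_mul_eq_one ((x - algebraMap F K a) * algebraMap F K b⁻¹) ?_)
    have : algebraMap F K b * algebraMap F K b⁻¹ = 1 := by rw [← map_mul]; simp [hb]
    linear_combination this - algebraMap F K b⁻¹ * hab
  subst hb
  have ha : a ≠ 0 := by
    rintro rfl
    exact hx0 (IsReduced.eq_zero x ⟨2, by simpa [sq] using hab.symm⟩)
  have hinv : algebraMap F K a * algebraMap F K a⁻¹ = 1 := by rw [← map_mul]; simp [ha]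
  left
  refine nonempty_algEquiv_prod_of_isIdempotentElem hK (e := algebraMap F K a⁻¹ * x) ?_ ?_ ?_
  · simp only [map_zero, zero_mul, add_zero] at hab
    linear_combination -(algebraMap F K a⁻¹) ^ 2 * hab + algebraMap F K a⁻¹ * x * hinv
  · intro h
    exact hx0 (by linear_combination algebraMap F K a * h - x * hinv)
  · intro h
    exact hxu (IsUnit.of_mul_eq_one (algebraMap F K a⁻¹) (by rw [mul_comm, h]))

lemma algebraMap_two_inv_mul_two {F : Type} [Field F] (R : Type) [CommRing R] [Algebra F R]
    (hchar : (2 : F) ≠ 0) : algebraMap F R 2⁻¹ * 2 = 1 := by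
  rw [← map_ofNat (algebraMap F R) 2, ← map_mul, inv_mul_cancel₀ hchar, map_one]

namespace K3A

variable {F R : Type} [Field F] [CommRing R] [Algebra F R]

lemma mul_apply_zero (x y : K3A F R) : (x * y) 0 = x 0 * y 0 + (x 1 * y 2 - x 2 * y 1) := rfl
lemma mul_apply_one (x y : K3A F R) :
    (x * y) 1 = algebraMap F R 2⁻¹ * (x 0 * y 1 + y 0 * x 1) := rfl
lemma mul_apply_two (x y : K3A F R) :
    (x * y) 2 = algebraMap F R 2⁻¹ * (x 0 * y 2 + y 0 * x 2) := rfl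

lemma ext_coord {x y : K3A F R} (h0 : x 0 = y 0) (h1 : x 1 = y 1) (h2 : x 2 = y 2) : x = y := by
  funext i
  fin_cases i <;> assumption

/-- The element of `K₃ ⊗ R` with the given coordinates. -/
def ofCoords (x y z : R) : K3A F R := ![x, y, z]

@[simp] lemma ofCoords_zero (x y z : R) : (ofCoords x y z : K3A F R) 0 = x := rfl
@[simp] lemma ofCoords_one (x y z : R) : (ofCoords x y z : K3A F R) 1 = y := rfl
@[simp] lemma ofCoords_two (x y z : R) : (ofCoords x y z : K3A F R) 2 = z := rfl

variable {S : Type} [Semiring S] [Module S R]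

lemma mem_even_iff {x : K3A F R} : x ∈ even F R S ↔ x 1 = 0 ∧ x 2 = 0 := by
  change (∀ i, i ∉ ({0} : Set (Fin 3)) → x i = 0) ↔ _
  simp [Fin.forall_fin_succ]

lemma mem_odd_iff {x : K3A F R} : x ∈ odd F R S ↔ x 0 = 0 := by
  change (∀ i, i ∉ ({1, 2} : Set (Fin 3)) → x i = 0) ↔ _
  simp [Fin.forall_fin_succ]

variable (F R S)

lemma even_sup_odd : even F R S ⊔ odd F R S = ⊤ := by
  refine eq_top_iff.2 fun x _ => Submodule.mem_sup.2
    ⟨ofCoords (x 0) 0 0, mem_even_iff.2 ⟨rfl, rfl⟩, ofCoords 0 (x 1) (x 2), mem_odd_iff.2 rfl, ?_⟩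
  apply ext_coord <;> simp

lemma even_inf_odd : even F R S ⊓ odd F R S = ⊥ := by
  refine eq_bot_iff.2 fun x hx => (Submodule.mem_bot S).2 ?_
  obtain ⟨h1, h2⟩ := mem_even_iff.1 hx.1
  exact ext_coord (mem_odd_iff.1 hx.2) h1 h2

lemma finrank_eq [FiniteDimensional F R] : Module.finrank F (K3A F R) = 3 * Module.finrank F R := by
  change Module.finrank F (Fin 3 → R) = _
  simp [Module.finrank_pi_fintype]

instance [FiniteDimensional F R] : FiniteDimensional F (K3A F R) :=
  inferInstanceAs (FiniteDimensional F (Fin 3 → R))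

end K3A

namespace K33A

variable {F R : Type} [Field F] [CommRing R] [Algebra F R]

lemma mul_apply_zero (x y : K33A F R) : (x * y) 0 = x 0 * y 0 + (x 1 * y 2 - x 2 * y 1) := rfl
lemma mul_apply_one (x y : K33A F R) :
    (x * y) 1 = algebraMap F R 2⁻¹ * (x 0 * y 1 + y 0 * x 1) := rfl
lemma mul_apply_two (x y : K33A F R) :
    (x * y) 2 = algebraMap F R 2⁻¹ * (x 0 * y 2 + y 0 * x 2) := rfl
lemma mul_apply_three (x y : K33A F R) : (x * y) 3 = x 3 * y 3 + (x 4 * y 5 - x 5 * y 4) := rfl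
lemma mul_apply_four (x y : K33A F R) :
    (x * y) 4 = algebraMap F R 2⁻¹ * (x 3 * y 4 + y 3 * x 4) := rfl
lemma mul_apply_five (x y : K33A F R) :
    (x * y) 5 = algebraMap F R 2⁻¹ * (x 3 * y 5 + y 3 * x 5) := rfl

lemma ext_coord {x y : K33A F R} (h0 : x 0 = y 0) (h1 : x 1 = y 1) (h2 : x 2 = y 2)
    (h3 : x 3 = y 3) (h4 : x 4 = y 4) (h5 : x 5 = y 5) : x = y := by
  funext i
  fin_cases i <;> assumption

/-- The element of `(K₃ × K₃) ⊗ R` with the given coordinates. -/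
def ofCoords (x₀ x₁ x₂ x₃ x₄ x₅ : R) : K33A F R := ![x₀, x₁, x₂, x₃, x₄, x₅]

section

variable (x₀ x₁ x₂ x₃ x₄ x₅ : R)

@[simp] lemma ofCoords_zero : (ofCoords x₀ x₁ x₂ x₃ x₄ x₅ : K33A F R) 0 = x₀ := rfl
@[simp] lemma ofCoords_one : (ofCoords x₀ x₁ x₂ x₃ x₄ x₅ : K33A F R) 1 = x₁ := rfl
@[simp] lemma ofCoords_two : (ofCoords x₀ x₁ x₂ x₃ x₄ x₅ : K33A F R) 2 = x₂ := rfl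
@[simp] lemma ofCoords_three : (ofCoords x₀ x₁ x₂ x₃ x₄ x₅ : K33A F R) 3 = x₃ := rfl
@[simp] lemma ofCoords_four : (ofCoords x₀ x₁ x₂ x₃ x₄ x₅ : K33A F R) 4 = x₄ := rfl
@[simp] lemma ofCoords_five : (ofCoords x₀ x₁ x₂ x₃ x₄ x₅ : K33A F R) 5 = x₅ := rfl

end

variable {S : Type} [Semiring S] [Module S R]

lemma mem_even_iff {x : K33A F R} : x ∈ even F R S ↔ x 1 = 0 ∧ x 2 = 0 ∧ x 4 = 0 ∧ x 5 = 0 := by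
  change (∀ i, i ∉ ({0, 3} : Set (Fin 6)) → x i = 0) ↔ _
  simp [Fin.forall_fin_succ]

lemma mem_odd_iff {x : K33A F R} : x ∈ odd F R S ↔ x 0 = 0 ∧ x 3 = 0 := by
  change (∀ i, i ∉ ({1, 2, 4, 5} : Set (Fin 6)) → x i = 0) ↔ _
  simp [Fin.forall_fin_succ]

variable (F R S)

lemma even_inf_odd : even F R S ⊓ odd F R S = ⊥ := by
  refine eq_bot_iff.2 fun x hx => (Submodule.mem_bot S).2 ?_
  obtain ⟨h1, h2, h4, h5⟩ := mem_even_iff.1 hx.1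
  obtain ⟨h0, h3⟩ := mem_odd_iff.1 hx.2
  exact ext_coord h0 h1 h2 h3 h4 h5

/-- The even part has coordinates `0` and `3`. -/
def evenEquiv : even F R R ≃ₗ[R] (R × R) where
  toFun x := (x.1 0, x.1 3)
  map_add' _ _ := rfl
  map_smul' _ _ := rfl
  invFun y := ⟨ofCoords y.1 0 0 y.2 0 0, mem_even_iff.2 ⟨rfl, rfl, rfl, rfl⟩⟩
  left_inv x := by
    obtain ⟨h1, h2, h4, h5⟩ := mem_even_iff.1 x.2
    exact Subtype.ext (ext_coord rfl h1.symm h2.symm rfl h4.symm h5.symm)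
  right_inv _ := rfl

lemma finrank_eq [Nontrivial R] : Module.finrank R (K33A F R) = 6 := by
  change Module.finrank R (Fin 6 → R) = _
  simp

instance : Module.Finite R (K33A F R) := inferInstanceAs (Module.Finite R (Fin 6 → R))

instance : IsScalarTower F R (K33A F R) := inferInstanceAs (IsScalarTower F R (Fin 6 → R))

/-- The coordinate `i` of `(K₃ × K₃) ⊗ R`, as a linear map. -/
def coord (i : Fin 6) : K33A F R →ₗ[S] R := LinearMap.proj (R := S) (φ := fun _ => R) i

end K33A

section Descent

variable {F Ω K B : Type} [Field F] [Field Ω] [Algebra F Ω] [CommRing K] [Algebra F K]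
  [NonUnitalNonAssocRing B] [Module F B] {evB odB : Submodule F B}

/-- The linear map `K₃ ⊗ K → B` determined by the images `l` of `K` and `u`, `v` of a symplectic
basis. -/
def K3A.lift [SMulCommClass F B B] [IsScalarTower F B B] (l : K →ₗ[F] B) (u v : B) :
    K3A F K →ₗ[F] B where
  toFun k := l (k 0) + (2 : F) • (l (k 1) * u + l (k 2) * v)
  map_add' x y := by
    simp only [K3A.add_apply, map_add, add_mul, smul_add]
    abel
  map_smul' c x := by
    simp only [K3A.smul_apply, map_smul, smul_mul_assoc, smul_add, RingHom.id_apply,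
      smul_comm c (2 : F)]

/-- A superalgebra embedded over `F` in `(K₃ × K₃) ⊗ Ω` whose even part is a quadratic algebra `K`
with unity `u * v`, for odd `u` and `v`, is isomorphic to `K₃ ⊗ K`. -/
lemma nonempty_superIso_of_embedding [SMulCommClass F B B] [IsScalarTower F B B]
    (hchar : (2 : F) ≠ 0) (hB : IsSuperalgebra F B evB odB) (hdim : Module.finrank F B = 6)
    (hK : Module.finrank F K = 2) (ψ : B →ₗ[F] K33A F Ω) (hψ : Function.Injective ψ)
    (hψmul : ∀ x y, ψ (x * y) = ψ x * ψ y) (hψodd : ∀ x ∈ odB, ψ x ∈ K33A.odd F Ω Ω)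
    (p q : K →ₐ[F] Ω) (hpq : ∀ k, p k = 0 → q k = 0 → k = 0) (l : K →ₗ[F] B)
    (hl : ∀ k, l k ∈ evB) (hψl : ∀ k, ψ (l k) = K33A.ofCoords (p k) 0 0 (q k) 0 0)
    {u v : B} (hu : u ∈ odB) (hv : v ∈ odB) (huv : u * v = l 1) :
    Nonempty (SuperIso F B (K3A F K) evB odB (K3A.even F K F) (K3A.odd F K F)) := by
  obtain ⟨-, hdisj, -, heo, -, -⟩ := hB
  have : FiniteDimensional F K := .of_finrank_pos (by omega)
  have : FiniteDimensional F B := .of_finrank_pos (by omega)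
  have h2 := algebraMap_two_inv_mul_two Ω hchar
  obtain ⟨hu0, hu3⟩ := K33A.mem_odd_iff.1 (hψodd u hu)
  obtain ⟨hv0, hv3⟩ := K33A.mem_odd_iff.1 (hψodd v hv)
  have huvψ : ψ u * ψ v = K33A.ofCoords 1 0 0 1 0 0 := by
    rw [← hψmul, huv, hψl, map_one, map_one]
  have hp1 : ψ u 1 * ψ v 2 - ψ u 2 * ψ v 1 = 1 := by
    simpa [K33A.mul_apply_zero, hu0] using congrArg (· 0) huvψ
  have hq1 : ψ u 4 * ψ v 5 - ψ u 5 * ψ v 4 = 1 := by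
    simpa [K33A.mul_apply_three, hu3] using congrArg (· 3) huvψ
  let f := K3A.lift l u v
  have hf : ∀ k, ψ (f k) = K33A.ofCoords (p (k 0)) (p (k 1) * ψ u 1 + p (k 2) * ψ v 1)
      (p (k 1) * ψ u 2 + p (k 2) * ψ v 2) (q (k 0)) (q (k 1) * ψ u 4 + q (k 2) * ψ v 4)
      (q (k 1) * ψ u 5 + q (k 2) * ψ v 5) := fun k => by
    have h2' : (2 : F) • (1 : Ω) = 2 := by rw [← Algebra.algebraMap_eq_smul_one, map_ofNat]
    have hsmul : ∀ x : Ω, (2 : F) • x = 2 * x := fun x => by rw [← h2', smul_one_mul]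
    have : ψ (f k) = ψ (l (k 0)) + (2 : F) • (ψ (l (k 1)) * ψ u + ψ (l (k 2)) * ψ v) := by
      simp [f, K3A.lift, hψmul]
    rw [this, hψl, hψl, hψl]
    apply K33A.ext_coord <;>
      simp only [K33A.add_apply, K33A.smul_apply, hsmul, K33A.mul_apply_zero, K33A.mul_apply_one,
        K33A.mul_apply_two, K33A.mul_apply_three, K33A.mul_apply_four, K33A.mul_apply_five,
        K33A.ofCoords_zero, K33A.ofCoords_one, K33A.ofCoords_two, K33A.ofCoords_three,
        K33A.ofCoords_four, K33A.ofCoords_five, hu0, hu3, hv0, hv3]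
    · ring
    · linear_combination (p (k 1) * ψ u 1 + p (k 2) * ψ v 1) * h2
    · linear_combination (p (k 1) * ψ u 2 + p (k 2) * ψ v 2) * h2
    · ring
    · linear_combination (q (k 1) * ψ u 4 + q (k 2) * ψ v 4) * h2
    · linear_combination (q (k 1) * ψ u 5 + q (k 2) * ψ v 5) * h2
  have hinj : Function.Injective f := by
    refine (injective_iff_map_eq_zero f).2 fun k hk => ?_
    have hk' := hf k
    rw [hk, map_zero] at hk'
    have h0 := congrArg (· 0) hk'
    have h1 := congrArg (· 1) hk'
    have h2 := congrArg (· 2) hk'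
    have h3 := congrArg (· 3) hk'
    have h4 := congrArg (· 4) hk'
    have h5 := congrArg (· 5) hk'
    simp only [K33A.ofCoords_zero, K33A.ofCoords_one, K33A.ofCoords_two, K33A.ofCoords_three,
        K33A.ofCoords_four, K33A.ofCoords_five, K33A.zero_apply] at h0 h1 h2 h3 h4 h5
    refine K3A.ext_coord (hpq _ h0.symm h3.symm) (hpq _ ?_ ?_) (hpq _ ?_ ?_)
    · linear_combination ψ v 1 * h2 - ψ v 2 * h1 - p (k 1) * hp1
    · linear_combination ψ v 4 * h5 - ψ v 5 * h4 - q (k 1) * hq1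
    · linear_combination ψ u 2 * h1 - ψ u 1 * h2 - p (k 2) * hp1
    · linear_combination ψ u 5 * h4 - ψ u 4 * h5 - q (k 2) * hq1
  let e := LinearEquiv.ofInjectiveOfFinrankEq f hinj (by rw [K3A.finrank_eq, hK, hdim])
  have he : ∀ k, e k = f k := fun _ => rfl
  have hmap := map_eq_of_le_of_disjoint e (K3A.even_sup_odd F K F) hdisj
    (fun k hk => by
      obtain ⟨h1, h2⟩ := K3A.mem_even_iff.1 hk
      simpa [he, f, K3A.lift, h1, h2] using hl (k 0))
    (fun k hk => by
      have h0 := K3A.mem_odd_iff.1 hk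
      simpa [he, f, K3A.lift, h0, -smul_add] using odB.smul_mem 2
        (odB.add_mem (heo _ (hl (k 1)) _ hu) (heo _ (hl (k 2)) _ hv)))
  refine ⟨SuperIso.symm ⟨e, fun x y => hψ ?_, hmap.1, hmap.2⟩⟩
  rw [he, he, he, hψmul, hf, hf, hf]
  apply K33A.ext_coord <;>
    simp only [K33A.mul_apply_zero, K33A.mul_apply_one,
      K33A.mul_apply_two, K33A.mul_apply_three, K33A.mul_apply_four, K33A.mul_apply_five,
      K33A.ofCoords_zero, K33A.ofCoords_one, K33A.ofCoords_two, K33A.ofCoords_three,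
      K33A.ofCoords_four, K33A.ofCoords_five, K3A.mul_apply_zero, K3A.mul_apply_one,
      K3A.mul_apply_two, map_add, map_sub, map_mul, AlgHom.commutes]
  · linear_combination -(p (x 1) * p (y 2) - p (x 2) * p (y 1)) * hp1
  · ring
  · ring
  · linear_combination -(q (x 1) * q (y 2) - q (x 2) * q (y 1)) * hq1
  · ring
  · ring

end Descent

section Descent

variable {F Ω B : Type} [Field F] [Field Ω] [Algebra F Ω] [NonUnitalNonAssocRing B] [Module F B]
  {evB odB : Submodule F B}

/-- A coordinate of the product of two odd elements, as a bilinear map. -/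
def oddPairing [SMulCommClass F B B] [IsScalarTower F B B] (ψ : B →ₗ[F] K33A F Ω)
    (odB : Submodule F B) (i : Fin 6) : odB →ₗ[F] odB →ₗ[F] Ω :=
  ((LinearMap.mul F B).domRestrict₁₂ odB odB).compr₂
    ((K33A.coord F Ω F i).comp ψ)

lemma oddPairing_ne_zero [SMulCommClass F B B] [IsScalarTower F B B] {ψ : B →ₗ[F] K33A F Ω}
    (hψmul : ∀ x y, ψ (x * y) = ψ x * ψ y)
    (hspan : K33A.odd F Ω Ω ≤ Submodule.span Ω (ψ '' odB)) {i : Fin 6} (hi : i = 0 ∨ i = 3) :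
    oddPairing ψ odB i ≠ 0 := by
  intro h
  let β : K33A F Ω →ₗ[Ω] K33A F Ω →ₗ[Ω] Ω := LinearMap.mk₂ Ω (fun x y => (x * y) i)
    (fun x x' y => by
      rcases hi with rfl | rfl <;> simp [K33A.mul_apply_zero, K33A.mul_apply_three] <;> ring)
    (fun c x y => by
      rcases hi with rfl | rfl <;> simp [K33A.mul_apply_zero, K33A.mul_apply_three] <;> ring)
    (fun x y y' => by
      rcases hi with rfl | rfl <;> simp [K33A.mul_apply_zero, K33A.mul_apply_three] <;> ring)
    (fun c x y => by
      rcases hi with rfl | rfl <;> simp [K33A.mul_apply_zero, K33A.mul_apply_three] <;> ring)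
  have hβ : ∀ x ∈ K33A.odd F Ω Ω, ∀ y ∈ K33A.odd F Ω Ω, (x * y) i = 0 := by
    intro x hx y hy
    change β x y = 0
    replace hx := hspan hx
    replace hy := hspan hy
    induction hx, hy using Submodule.span_induction₂ with
    | mem_mem x y hx hy =>
      obtain ⟨a, ha, rfl⟩ := hx
      obtain ⟨b, hb, rfl⟩ := hy
      rw [LinearMap.mk₂_apply, ← hψmul]
      exact LinearMap.congr_fun₂ h ⟨a, ha⟩ ⟨b, hb⟩
    | zero_left y hy => simp
    | zero_right x hx => simp
    | add_left x y z _ _ _ hx hy => simp [hx, hy]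
    | add_right x y z _ _ _ hx hy => simp [hx, hy]
    | smul_left r x y _ _ h => simp [h]
    | smul_right r x y _ _ h => simp [h]
  have := hβ (K33A.ofCoords 0 1 0 0 1 0) (K33A.mem_odd_iff.2 ⟨rfl, rfl⟩)
    (K33A.ofCoords 0 0 1 0 0 1) (K33A.mem_odd_iff.2 ⟨rfl, rfl⟩)
  rcases hi with rfl | rfl <;> simp [K33A.mul_apply_zero, K33A.mul_apply_three] at this

/-- A superalgebra embedded over `F` in `(K₃ × K₃) ⊗ Ω` as an `F`-form is isomorphic to `K₃ ⊗ K`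
for a quadratic étale algebra `K`. -/
lemma nonempty_quadEtaleWitness_of_embedding [SMulCommClass F B B] [IsScalarTower F B B]
    (hchar : (2 : F) ≠ 0) (hB : IsSuperalgebra F B evB odB) (hdim : Module.finrank F B = 6)
    (hev : Module.finrank F evB = 2) (ψ : B →ₗ[F] K33A F Ω) (hψ : Function.Injective ψ)
    (hψmul : ∀ x y, ψ (x * y) = ψ x * ψ y) (hψeven : ∀ x ∈ evB, ψ x ∈ K33A.even F Ω Ω)
    (hψodd : ∀ x ∈ odB, ψ x ∈ K33A.odd F Ω Ω)
    (hspan : K33A.odd F Ω Ω ≤ Submodule.span Ω (ψ '' odB)) :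
    Nonempty (QuadEtaleWitness F B evB odB) := by
  have : FiniteDimensional F evB := .of_finrank_pos (by omega)
  have h2 := algebraMap_two_inv_mul_two Ω hchar
  have hB' := hB
  obtain ⟨-, -, hee, heo, -, hoo⟩ := hB'
  let π : B →ₗ[F] Ω × Ω := ((K33A.coord F Ω F 0).prod (K33A.coord F Ω F 3)).comp ψ
  have hπ : ∀ x, π x = (ψ x 0, ψ x 3) := fun _ => rfl
  have hψπ : ∀ x ∈ evB, ψ x = K33A.ofCoords (π x).1 0 0 (π x).2 0 0 := fun x hx => by
    obtain ⟨h1, h2, h4, h5⟩ := K33A.mem_even_iff.1 (hψeven x hx)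
    exact K33A.ext_coord rfl h1 h2 rfl h4 h5
  have hπmul : ∀ x ∈ evB, ∀ y ∈ evB, π (x * y) = π x * π y := fun x hx y hy => by
    rw [hπ (x * y), hψmul, hψπ x hx, hψπ y hy]
    simp [Prod.ext_iff, K33A.mul_apply_zero, K33A.mul_apply_three]
  have hπinj : Function.Injective (π.domRestrict evB) := fun x y hxy => by
    have hxy' : π x = π y := hxy
    exact Subtype.ext (hψ (by rw [hψπ x x.2, hψπ y y.2, hxy']))
  obtain ⟨u, hu0, hu3⟩ := exists_apply_ne_zero_and
    (oddPairing_ne_zero hψmul hspan (.inl rfl)) (oddPairing_ne_zero hψmul hspan (.inr rfl))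
  obtain ⟨v, hv0, hv3⟩ := exists_apply_ne_zero_and hu0 hu3
  replace hv0 : (π (u * v)).1 ≠ 0 := hv0
  replace hv3 : (π (u * v)).2 ≠ 0 := hv3
  have huv : (u * v : B) ∈ evB := hoo _ u.2 _ v.2
  let m : evB →ₗ[F] evB := (LinearMap.mul F B (u * v)).restrict fun x hx => hee _ huv x hx
  have hm : ∀ x, π (m x) = π (u * v) * π x := fun x => hπmul _ huv x x.2
  have hminj : Function.Injective m := fun x y hxy => hπinj <| by
    have := congrArg (fun z : evB => π z) hxy
    simp only [hm, Prod.ext_iff, Prod.fst_mul, Prod.snd_mul] at this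
    exact Prod.ext (mul_left_cancel₀ hv0 this.1) (mul_left_cancel₀ hv3 this.2)
  have hmsurj := LinearMap.injective_iff_surjective.1 hminj
  obtain ⟨e, he⟩ := hmsurj ⟨u * v, huv⟩
  obtain ⟨d, hd⟩ := hmsurj e
  replace he : π (u * v) * π e = π (u * v) := by rw [← hm, he]
  replace he : π e = 1 := by
    rw [Prod.ext_iff] at he
    exact Prod.ext (mul_left_cancel₀ hv0 (by simpa using he.1))
      (mul_left_cancel₀ hv3 (by simpa using he.2))
  replace hd : π (u * v) * π d = 1 := by rw [← hm, hd, he]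
  let w : B := (2 : F) • ((d : B) * v)
  have hw : w ∈ odB := odB.smul_mem _ (heo _ d.2 _ v.2)
  have huw : π (u * w) = π e := by
    rw [he, ← hd]
    obtain ⟨hu0, hu3⟩ := K33A.mem_odd_iff.1 (hψodd u u.2)
    obtain ⟨hv0, hv3⟩ := K33A.mem_odd_iff.1 (hψodd v v.2)
    have hsmul : ∀ x : Ω, (2 : F) • x = 2 * x := fun x => by
      rw [Algebra.smul_def, map_ofNat]
    have hψw : ψ w = (2 : F) • (ψ d * ψ v) := by simp only [w, map_smul, hψmul]
    rw [hπ (u * w), hπ (u * v), hψmul, hψmul, hψw, hψπ d d.2]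
    simp only [Prod.ext_iff, Prod.fst_mul, Prod.snd_mul, K33A.smul_apply, hsmul,
      K33A.mul_apply_zero, K33A.mul_apply_one,
      K33A.mul_apply_two, K33A.mul_apply_three, K33A.mul_apply_four, K33A.mul_apply_five,
      K33A.ofCoords_zero, K33A.ofCoords_one, K33A.ofCoords_two, K33A.ofCoords_three,
      K33A.ofCoords_four, K33A.ofCoords_five, hu0, hu3, hv0, hv3]
    constructor
    · linear_combination (π d).1 * (ψ u 1 * ψ v 2 - ψ u 2 * ψ v 1) * h2
    · linear_combination (π d).2 * (ψ u 4 * ψ v 5 - ψ u 5 * ψ v 4) * h2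
  replace huw : u * w = (e : B) := congrArg Subtype.val <|
    @hπinj ⟨u * w, hoo _ u.2 _ hw⟩ e huw
  let K : Subalgebra F (Ω × Ω) := (LinearMap.range (π.domRestrict evB)).toSubalgebra ⟨e, he⟩ (by
    rintro _ _ ⟨x, rfl⟩ ⟨y, rfl⟩
    exact ⟨⟨x * y, hee _ x.2 _ y.2⟩, hπmul x x.2 y y.2⟩)
  let l : evB ≃ₗ[F] K := LinearEquiv.ofInjective (π.domRestrict evB) hπinj
  have hl : ∀ k : K, π (l.symm k) = k := fun k => congrArg Subtype.val (l.apply_symm_apply k)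
  have hKdim : Module.finrank F K = 2 := l.finrank_eq.symm.trans hev
  have hl1 : l.symm 1 = e := by
    rw [LinearEquiv.symm_apply_eq]
    exact Subtype.ext he.symm
  have : IsReduced K := isReduced_of_injective K.val Subtype.val_injective
  obtain ⟨iso⟩ := nonempty_superIso_of_embedding hchar hB hdim hKdim ψ hψ hψmul hψodd
    ((AlgHom.fst F Ω Ω).comp K.val) ((AlgHom.snd F Ω Ω).comp K.val)
    (fun k h h' => Subtype.ext (Prod.ext h h')) (evB.subtype ∘ₗ l.symm.toLinearMap)
    (fun k => (l.symm k).2)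
    (fun k => by
      rw [LinearMap.comp_apply, Submodule.subtype_apply, LinearEquiv.coe_coe,
        hψπ _ (l.symm k).2, hl]
      rfl)
    u.2 hw (by simp [huw, hl1])
  exact ⟨⟨K, isQuadraticEtale_of_isReduced hchar hKdim, iso⟩⟩

end Descent

/-- The geometric points of a quadratic étale algebra: two distinct homomorphisms to an
algebraically closed field. -/
lemma IsQuadraticEtale.exists_algHom_ne {F K : Type} [Field F] [CommRing K] [Algebra F K]
    (hK : IsQuadraticEtale F K) (Ω : Type) [Field Ω] [Algebra F Ω] [IsAlgClosed Ω] :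
    ∃ (p q : K →ₐ[F] Ω) (x : K), p x ≠ q x := by
  obtain ⟨hdim, ⟨⟨e⟩⟩ | ⟨hfield, hsep⟩⟩ := hK
  · exact ⟨((Algebra.ofId F Ω).comp (AlgHom.fst F F F)).comp e.toAlgHom,
      ((Algebra.ofId F Ω).comp (AlgHom.snd F F F)).comp e.toAlgHom, e.symm (1, 0), by simp⟩
  · let := hfield.toField
    have : FiniteDimensional F K := .of_finrank_pos (by omega)
    have hcard : 1 < Fintype.card (K →ₐ[F] Ω) := by rw [AlgHom.card F K Ω, hdim]; norm_num
    obtain ⟨p, q, hpq⟩ := Fintype.one_lt_card_iff.1 hcard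
    exact ⟨p, q, DFunLike.ne_iff.1 hpq⟩

namespace K33A

variable {F R : Type} [Field F] [CommRing R] [Algebra F R]

lemma add_mul (x y z : K33A F R) : (x + y) * z = x * z + y * z := by
  apply ext_coord <;> simp only [mul_apply_zero, mul_apply_one, mul_apply_two, mul_apply_three,
    mul_apply_four, mul_apply_five, add_apply] <;> ring

lemma mul_add (x y z : K33A F R) : x * (y + z) = x * y + x * z := by
  apply ext_coord <;> simp only [mul_apply_zero, mul_apply_one, mul_apply_two, mul_apply_three,
    mul_apply_four, mul_apply_five, add_apply] <;> ring

lemma smul_mul_smul (a b : R) (x y : K33A F R) : (a • x) * (b • y) = (a * b) • (x * y) := by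
  apply ext_coord <;> simp only [mul_apply_zero, mul_apply_one, mul_apply_two, mul_apply_three,
    mul_apply_four, mul_apply_five, smul_apply, smul_eq_mul] <;> ring

end K33A

/-- The map `K₃ ⊗ K → (K₃ × K₃) ⊗ Ω` induced by two homomorphisms `K → Ω`. -/
def K3A.toK33A {F K Ω : Type} [Field F] [CommRing K] [Algebra F K] [CommRing Ω] [Algebra F Ω]
    (p q : K →ₐ[F] Ω) : K3A F K →ₗ[F] K33A F Ω where
  toFun k := K33A.ofCoords (p (k 0)) (p (k 1)) (p (k 2)) (q (k 0)) (q (k 1)) (q (k 2))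
  map_add' x y := by apply K33A.ext_coord <;> simp
  map_smul' c x := by apply K33A.ext_coord <;> simp

lemma K3A.toK33A_mul {F K Ω : Type} [Field F] [CommRing K] [Algebra F K] [CommRing Ω]
    [Algebra F Ω] (p q : K →ₐ[F] Ω) (x y : K3A F K) :
    toK33A p q (x * y) = toK33A p q x * toK33A p q y := by
  apply K33A.ext_coord <;>
    simp [toK33A, K3A.mul_apply_zero, K3A.mul_apply_one, K3A.mul_apply_two, K33A.mul_apply_zero,
      K33A.mul_apply_one, K33A.mul_apply_two, K33A.mul_apply_three, K33A.mul_apply_four,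
      K33A.mul_apply_five]

lemma baseChange_sup_eq_top {F B : Type} (Ω : Type) [Field F] [CommRing Ω] [Algebra F Ω]
    [AddCommGroup B] [Module F B] {V W : Submodule F B} (h : V ⊔ W = ⊤) :
    V.baseChange Ω ⊔ W.baseChange Ω = ⊤ := by
  refine eq_top_iff.2 fun t _ => ?_
  induction t with
  | zero => exact zero_mem _
  | add s t hs ht => exact add_mem (hs trivial) (ht trivial)
  | tmul a b =>
    obtain ⟨v, hv, w, hw, rfl⟩ := Submodule.mem_sup.1 (h ▸ Submodule.mem_top : b ∈ V ⊔ W)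
    rw [TensorProduct.tmul_add]
    exact Submodule.add_mem_sup (Submodule.tmul_mem_baseChange_of_mem _ hv)
      (Submodule.tmul_mem_baseChange_of_mem _ hw)

/-- A superalgebra isomorphic to `K₃ ⊗ K` with `K` quadratic étale becomes isomorphic to `K₃ × K₃`
over an algebraically closed field. -/
lemma nonempty_superIso_of_quadEtaleWitness {F Ω B : Type} [Field F] [Field Ω] [Algebra F Ω]
    [IsAlgClosed Ω] [NonUnitalNonAssocRing B] [Module F B] [SMulCommClass F B B]
    [IsScalarTower F B B] {evB odB : Submodule F B} (hB : IsSuperalgebra F B evB odB)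
    (h : QuadEtaleWitness F B evB odB) :
    Nonempty (SuperIso Ω (Ω ⊗[F] B) (K33A F Ω) (evB.baseChange Ω) (odB.baseChange Ω)
      (K33A.even F Ω Ω) (K33A.odd F Ω Ω)) := by
  obtain ⟨K, hK, iso⟩ := h
  obtain ⟨p, q, x, hx⟩ := hK.exists_algHom_ne Ω
  have : FiniteDimensional F K := .of_finrank_pos (by rw [hK.1]; norm_num)
  have : FiniteDimensional F B := Module.Finite.equiv iso.e.symm
  let f : Ω ⊗[F] B →ₗ[Ω] K33A F Ω :=
    ((K3A.toK33A p q).comp iso.e.toLinearMap).liftBaseChange Ω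
  have hf : ∀ a b, f (a ⊗ₜ b) = a • K3A.toK33A p q (iso.e b) := fun a b => by simp [f]
  have hsurj : Function.Surjective f := by
    intro y
    let b : Ω → Ω → Ω := fun s t => (s - t) / (p x - q x)
    let a : Ω → Ω → Ω := fun s t => s - b s t * p x
    have hp : ∀ s t, a s t + b s t * p x = s := fun s t => by simp [a]
    have hq : ∀ s t, a s t + b s t * q x = t := fun s t => by
      have : b s t * (p x - q x) = s - t := div_mul_cancel₀ _ (sub_ne_zero.2 hx)
      linear_combination hp s t - this
    let g : Ω → Ω → K3A F K → K3A F K → Ω ⊗[F] B := fun s t k k' =>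
      a s t ⊗ₜ iso.e.symm k + b s t ⊗ₜ iso.e.symm k'
    refine ⟨g (y 0) (y 3) (K3A.ofCoords 1 0 0) (K3A.ofCoords x 0 0) +
      g (y 1) (y 4) (K3A.ofCoords 0 1 0) (K3A.ofCoords 0 x 0) +
      g (y 2) (y 5) (K3A.ofCoords 0 0 1) (K3A.ofCoords 0 0 x), ?_⟩
    simp only [g, map_add, hf, LinearEquiv.apply_symm_apply]
    apply K33A.ext_coord <;> simp [K3A.toK33A, hp, hq]
  have hdim : Module.finrank Ω (Ω ⊗[F] B) = Module.finrank Ω (K33A F Ω) := by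
    rw [Module.finrank_baseChange, K33A.finrank_eq, iso.e.finrank_eq, K3A.finrank_eq, hK.1]
  have hinj : Function.Injective f :=
    (LinearMap.injective_iff_surjective_of_finrank_eq_finrank hdim).2 hsurj
  have hmul : ∀ s t, f (s * t) = f s * f t := by
    intro s t
    have h0 : ∀ y : K33A F Ω, 0 * y = 0 ∧ y * 0 = 0 := fun y => by
      constructor
      · simpa using K33A.smul_mul_smul 0 1 0 y
      · simpa using K33A.smul_mul_smul 1 0 y 0
    induction s with
    | zero => rw [zero_mul, map_zero, (h0 _).1]
    | add s s' hs hs' => rw [add_mul, map_add, hs, hs', map_add, K33A.add_mul]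
    | tmul a b =>
      induction t with
      | zero => rw [mul_zero, map_zero, (h0 _).2]
      | add t t' ht ht' => rw [mul_add, map_add, ht, ht', map_add, K33A.mul_add]
      | tmul c d =>
        rw [Algebra.TensorProduct.tmul_mul_tmul, hf, hf, hf, iso.map_mul', K3A.toK33A_mul,
          K33A.smul_mul_smul]
  let e : Ω ⊗[F] B ≃ₗ[Ω] K33A F Ω := LinearEquiv.ofBijective f ⟨hinj, hsurj⟩
  have hmem : ∀ {V : Submodule F B} {V' : Submodule Ω (K33A F Ω)},
      (∀ b ∈ V, K3A.toK33A p q (iso.e b) ∈ V') → ∀ t ∈ V.baseChange Ω, e t ∈ V' := by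
    intro V V' hV t ht
    rw [Submodule.baseChange_eq_span] at ht
    refine (Submodule.span_le (p := V'.comap e.toLinearMap)).2 ?_ ht
    rintro _ ⟨b, hb, rfl⟩
    have : e (1 ⊗ₜ b) = K3A.toK33A p q (iso.e b) := (hf 1 b).trans (one_smul _ _)
    simpa [this] using hV b hb
  have hmap := map_eq_of_le_of_disjoint e (baseChange_sup_eq_top Ω hB.1)
    (K33A.even_inf_odd F Ω Ω)
    (hmem fun b hb => by
      have := iso.apply_mem_even hb
      obtain ⟨h1, h2⟩ := K3A.mem_even_iff.1 this
      exact K33A.mem_even_iff.2 (by simp [K3A.toK33A, h1, h2]))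
    (hmem fun b hb => by
      have := iso.apply_mem_odd hb
      have h0 := K3A.mem_odd_iff.1 this
      exact K33A.mem_odd_iff.2 (by simp [K3A.toK33A, h0]))
  exact ⟨⟨e, hmul, hmap.1, hmap.2⟩⟩

/-- A twisted form of `K₃ × K₃` is isomorphic to `K₃ ⊗ K` for a quadratic étale algebra `K`. -/
lemma nonempty_quadEtaleWitness_of_superIso {F Ω B : Type} [Field F] [Field Ω] [Algebra F Ω]
    [NonUnitalNonAssocRing B] [Module F B] [SMulCommClass F B B]
    [IsScalarTower F B B] [FiniteDimensional F B] {evB odB : Submodule F B}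
    (hchar : (2 : F) ≠ 0) (hB : IsSuperalgebra F B evB odB)
    (φ : SuperIso Ω (Ω ⊗[F] B) (K33A F Ω) (evB.baseChange Ω) (odB.baseChange Ω)
      (K33A.even F Ω Ω) (K33A.odd F Ω Ω)) : Nonempty (QuadEtaleWitness F B evB odB) := by
  let ψ : B →ₗ[F] K33A F Ω := (φ.e.toLinearMap.restrictScalars F).comp (TensorProduct.mk F Ω B 1)
  have hψ : ∀ b, ψ b = φ.e (1 ⊗ₜ b) := fun _ => rfl
  refine nonempty_quadEtaleWitness_of_embedding hchar hB ?_ ?_ ψ ?_ ?_ ?_ ?_ ?_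
  · rw [← Module.finrank_baseChange (R := Ω), φ.e.finrank_eq, K33A.finrank_eq]
  · rw [← Module.finrank_baseChange (R := Ω),
      (Submodule.toBaseChange.toLinearEquiv Ω evB).finrank_eq, ← φ.e.finrank_map_eq, φ.map_even,
      (K33A.evenEquiv F Ω).finrank_eq]
    simp
  · exact φ.e.injective.comp (Module.Flat.tensorProduct_mk_injective (R := F) (M := B) (S := Ω))
  · intro x y
    rw [hψ, hψ, hψ, ← φ.map_mul', Algebra.TensorProduct.tmul_mul_tmul, one_mul]
  · exact fun x hx => φ.apply_mem_even (Submodule.tmul_mem_baseChange_of_mem _ hx)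
  · exact fun x hx => φ.apply_mem_odd (Submodule.tmul_mem_baseChange_of_mem _ hx)
  · refine φ.map_odd.ge.trans (Submodule.map_le_iff_le_comap.2 ?_)
    refine (Submodule.baseChange_eq_span (A := Ω) odB).le.trans (Submodule.span_le.2 ?_)
    rintro _ ⟨b, hb, rfl⟩
    exact Submodule.subset_span ⟨b, hb, rfl⟩

/-- The superalgebra `K₃ ⊗ K` determines the algebra `K`, its even part. -/
lemma nonempty_algEquiv_of_superIso {F K K' : Type} [Field F] [CommRing K] [Algebra F K]
    [CommRing K'] [Algebra F K']
    (φ : SuperIso F (K3A F K) (K3A F K') (K3A.even F K F) (K3A.odd F K F) (K3A.even F K' F)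
      (K3A.odd F K' F)) : Nonempty (K ≃ₐ[F] K') := by
  have hφ : ∀ k, ∃ k', φ.e (K3A.ofCoords k 0 0) = K3A.ofCoords k' 0 0 := fun k => by
    have : φ.e (K3A.ofCoords k 0 0) ∈ K3A.even F K' F :=
      φ.apply_mem_even (K3A.mem_even_iff.2 ⟨rfl, rfl⟩)
    obtain ⟨h1, h2⟩ := K3A.mem_even_iff.1 this
    exact ⟨_, K3A.ext_coord rfl h1 h2⟩
  have hadd : ∀ k l : K, (K3A.ofCoords (k + l) 0 0 : K3A F K) =
      K3A.ofCoords k 0 0 + K3A.ofCoords l 0 0 := fun k l => by apply K3A.ext_coord <;> simp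
  have hsmul : ∀ (c : F) (k : K), (K3A.ofCoords (c • k) 0 0 : K3A F K) =
      c • K3A.ofCoords k 0 0 := fun c k => by apply K3A.ext_coord <;> simp
  have hmul : ∀ (k l : K), (K3A.ofCoords (k * l) 0 0 : K3A F K) =
      K3A.ofCoords k 0 0 * K3A.ofCoords l 0 0 := fun k l => by
    apply K3A.ext_coord <;> simp [K3A.mul_apply_zero, K3A.mul_apply_one, K3A.mul_apply_two]
  let g : K →ₗ[F] K' :=
    { toFun := fun k => φ.e (K3A.ofCoords k 0 0) 0
      map_add' := fun k l => by simp [hadd]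
      map_smul' := fun c k => by simp [hsmul] }
  have hg : ∀ k, φ.e (K3A.ofCoords k 0 0) = K3A.ofCoords (g k) 0 0 := fun k => by
    obtain ⟨k', hk'⟩ := hφ k
    have : g k = k' := congrArg (· 0) hk'
    rw [hk', this]
  have hgmul : ∀ k l, g (k * l) = g k * g l := fun k l => by
    change φ.e _ 0 = _
    rw [hmul, φ.map_mul', hg, hg]
    simp [K3A.mul_apply_zero]
  have hginj : Function.Injective g := fun k l hkl => by
    have := φ.e.injective ((hg k).trans (hkl ▸ (hg l).symm))
    exact congrArg (· 0) this
  have hgsurj : Function.Surjective g := fun k' => by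
    have : (K3A.ofCoords k' 0 0 : K3A F K') ∈ K3A.even F K' F := K3A.mem_even_iff.2 ⟨rfl, rfl⟩
    rw [← φ.map_even] at this
    obtain ⟨x, hx, hxk⟩ := this
    obtain ⟨h1, h2⟩ := K3A.mem_even_iff.1 hx
    refine ⟨x 0, ?_⟩
    have hx' : x = K3A.ofCoords (x 0) 0 0 := K3A.ext_coord rfl h1 h2
    change φ.e _ 0 = _
    rw [← hx']
    exact congrArg (· 0) hxk
  have hg1 : g 1 = 1 := by
    obtain ⟨k, hk⟩ := hgsurj 1
    rw [← mul_one (g 1), ← hk, ← hgmul, one_mul]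
  exact ⟨AlgEquiv.ofLinearEquiv (LinearEquiv.ofBijective g ⟨hginj, hgsurj⟩) hg1 hgmul⟩

/-- Isomorphic algebras have isomorphic tensor products with `K₃`. -/
lemma nonempty_superIso_of_algEquiv {F K K' : Type} [Field F] [CommRing K] [Algebra F K]
    [CommRing K'] [Algebra F K'] (g : K ≃ₐ[F] K') :
    Nonempty (SuperIso F (K3A F K) (K3A F K') (K3A.even F K F) (K3A.odd F K F) (K3A.even F K' F)
      (K3A.odd F K' F)) := by
  let e : K3A F K ≃ₗ[F] K3A F K' := LinearEquiv.piCongrRight fun _ : Fin 3 => g.toLinearEquiv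
  have he : ∀ x i, e x i = g (x i) := fun _ _ => rfl
  have hmap := map_eq_of_le_of_disjoint e (K3A.even_sup_odd F K F) (K3A.even_inf_odd F K' F)
    (fun x hx => by
      obtain ⟨h1, h2⟩ := K3A.mem_even_iff.1 hx
      exact K3A.mem_even_iff.2 (by simp [he, h1, h2]))
    (fun x hx => K3A.mem_odd_iff.2 (by simp [he, K3A.mem_odd_iff.1 hx]))
  refine ⟨⟨e, fun x y => ?_, hmap.1, hmap.2⟩⟩
  apply K3A.ext_coord <;> simp [he, K3A.mul_apply_zero, K3A.mul_apply_one, K3A.mul_apply_two]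

end Kac

open Kac in
/-- The twisted forms of `K₃ × K₃` over `F` are, up to isomorphism, exactly the
superalgebras `K₃ ⊗_F K` with `K` a quadratic étale `F`-algebra; and two such
forms are isomorphic iff the corresponding étale algebras are.  Here
`(K₃ × K₃) ⊗_F F̄` is realized as `K33A F F̄` and `K₃ ⊗_F K` as `K3A F K`
(with even part `Fa ⊗ K` and odd part `W ⊗ K`). -/
theorem twisted_forms_of_K3xK3_classification (F : Type) [Field F] (hchar : (2 : F) ≠ 0) :
    (∀ (B : Type) (_ : NonUnitalNonAssocRing B) (_ : Module F B)
      (_ : SMulCommClass F B B) (_ : IsScalarTower F B B) (_ : FiniteDimensional F B)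
      (evB odB : Submodule F B), IsSuperalgebra F B evB odB →
      (Nonempty (SuperIso (AlgebraicClosure F)
          ((AlgebraicClosure F) ⊗[F] B) (K33A F (AlgebraicClosure F))
          (evB.baseChange (AlgebraicClosure F)) (odB.baseChange (AlgebraicClosure F))
          (K33A.even F (AlgebraicClosure F) (AlgebraicClosure F))
          (K33A.odd F (AlgebraicClosure F) (AlgebraicClosure F))) ↔
        Nonempty (QuadEtaleWitness F B evB odB))) ∧
    (∀ (K K' : Type) (_ : CommRing K) (_ : Algebra F K) (_ : CommRing K') (_ : Algebra F K'),
      IsQuadraticEtale F K → IsQuadraticEtale F K' →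
      (Nonempty (SuperIso F (K3A F K) (K3A F K')
          (K3A.even F K F) (K3A.odd F K F) (K3A.even F K' F) (K3A.odd F K' F)) ↔
        Nonempty (K ≃ₐ[F] K'))) := by
  refine ⟨fun B _ _ _ _ _ evB odB hB =>
      ⟨fun ⟨φ⟩ => nonempty_quadEtaleWitness_of_superIso hchar hB φ,
        fun ⟨h⟩ => nonempty_superIso_of_quadEtaleWitness hB h⟩,
    fun K K' _ _ _ _ _ _ =>
      ⟨fun ⟨φ⟩ => nonempty_algEquiv_of_superIso φ, fun ⟨g⟩ => nonempty_superIso_of_algEquiv g⟩⟩
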